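/- Let λ > 0, t < T, θ̂ > 0 and β, ρ ∈ ℝ. For s ∈ [t,T) define ε(s,T) = (1 − exp(−λ(T−s)))/λ, Δ₁(s) = (β + ρ/ε(s,T))² + 2θ̂/ε(s,T), θ₋ = sup_{s ∈ [t,T)} ( −β − ρ/ε(s,T) − √(Δ₁(s)) ) and θ₊ = inf_{s ∈ [t,T)} ( −β − ρ/ε(s,T) + √(Δ₁(s)) ). Then for every z ∈ ℂ with θ₋ < Re(z) < θ₊ and every s ∈ [t,T), one has Re(ρ z + (1/2)(z² + 2βz) ε(s,T)) < θ̂. -/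

import Mathlib

/-- The expression `a * x ^ 2 / 2 + (ρ + β * a) * x` stays below `c` strictly between the two roots
of the corresponding quadratic equation. -/
theorem quadratic_lt_of_mem_Ioo_roots {a c β ρ x : ℝ} (ha : 0 < a) (hc : 0 < c)
    (hl : -β - ρ / a - Real.sqrt ((β + ρ / a) ^ 2 + 2 * c / a) < x)
    (hu : x < -β - ρ / a + Real.sqrt ((β + ρ / a) ^ 2 + 2 * c / a)) :
    ρ * x + 1 / 2 * (x ^ 2 + 2 * β * x) * a < c := by
  have hΔ : 0 ≤ (β + ρ / a) ^ 2 + 2 * c / a := by positivity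
  have hsq : (x + (β + ρ / a)) ^ 2 < (β + ρ / a) ^ 2 + 2 * c / a := by
    rw [← Real.sq_sqrt hΔ]
    exact sq_lt_sq' (by linarith) (by linarith)
  have hlt : a / 2 * (x + (β + ρ / a)) ^ 2 < a / 2 * ((β + ρ / a) ^ 2 + 2 * c / a) :=
    mul_lt_mul_of_pos_left hsq (by positivity)
  have hdiff : a / 2 * ((β + ρ / a) ^ 2 + 2 * c / a) - a / 2 * (x + (β + ρ / a)) ^ 2 =
      c - (ρ * x + 1 / 2 * (x ^ 2 + 2 * β * x) * a) := by
    field_simp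
    ring
  linarith

theorem stmt_1 (lam t T θhat β ρ : ℝ) (hlam : 0 < lam) (htT : t < T) (hθ : 0 < θhat)
    (ε : ℝ → ℝ) (hε : ∀ s, ε s = (1 - Real.exp (-lam * (T - s))) / lam)
    (Δ₁ : ℝ → ℝ) (hΔ : ∀ s, Δ₁ s = (β + ρ / ε s) ^ 2 + 2 * θhat / ε s)
    (θm θp : ℝ)
    (hθm : θm = sSup ((fun s => -β - ρ / ε s - Real.sqrt (Δ₁ s)) '' Set.Ico t T))
    (hθp : θp = sInf ((fun s => -β - ρ / ε s + Real.sqrt (Δ₁ s)) '' Set.Ico t T)) :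
    ∀ z : ℂ, θm < z.re → z.re < θp →
      ∀ s ∈ Set.Ico t T,
        (ρ * z + (1 / 2 : ℂ) * (z ^ 2 + 2 * β * z) * (ε s : ℂ)).re < θhat := by
  have hεpos : ∀ s ∈ Set.Ico t T, 0 < ε s := by
    intro s hs
    rw [hε]
    have hexp : Real.exp (-lam * (T - s)) < 1 :=
      Real.exp_lt_one_iff.2 (by nlinarith [mul_pos hlam (sub_pos.2 hs.2)])
    exact div_pos (by linarith) hlam
  have habs : ∀ s ∈ Set.Ico t T, |β + ρ / ε s| ≤ Real.sqrt (Δ₁ s) := by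
    intro s hs
    have hpos := hεpos s hs
    apply Real.abs_le_sqrt
    rw [hΔ]
    exact le_add_of_nonneg_right (by positivity)
  intro z hzm hzp s hs
  have hpos := hεpos s hs
  have hl : -β - ρ / ε s - Real.sqrt (Δ₁ s) < z.re := by
    refine lt_of_le_of_lt ?_ hzm
    rw [hθm]
    refine le_csSup ⟨0, ?_⟩ (Set.mem_image_of_mem _ hs)
    rintro _ ⟨r, hr, rfl⟩
    have := neg_le_of_abs_le (habs r hr)
    dsimp only
    linarith
  have hu : z.re < -β - ρ / ε s + Real.sqrt (Δ₁ s) := by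
    refine lt_of_lt_of_le hzp ?_
    rw [hθp]
    refine csInf_le ⟨0, ?_⟩ (Set.mem_image_of_mem _ hs)
    rintro _ ⟨r, hr, rfl⟩
    have := le_of_abs_le (habs r hr)
    dsimp only
    linarith
  rw [hΔ] at hl hu
  have hquad := quadratic_lt_of_mem_Ioo_roots hpos hθ hl hu
  have hre : (ρ * z + (1 / 2 : ℂ) * (z ^ 2 + 2 * β * z) * (ε s : ℂ)).re =
      ρ * z.re + 1 / 2 * (z.re ^ 2 + 2 * β * z.re) * ε s - 1 / 2 * z.im ^ 2 * ε s := by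
    have hhalf : (1 / 2 : ℂ) = ((1 / 2 : ℝ) : ℂ) := by norm_num
    rw [hhalf]
    simp only [Complex.add_re, Complex.mul_re, Complex.mul_im, Complex.add_im, Complex.ofReal_re,
      Complex.ofReal_im, Complex.re_ofNat, Complex.im_ofNat, pow_two]
    ring
  have him : 0 ≤ 1 / 2 * z.im ^ 2 * ε s := by positivity
  linarith
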